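/- If σ₀(m) denotes the number of positive divisors of m, then for every integer m ≥ 3 one has σ₀(m) < m^{1.1 / log log m}. -/

import Mathlib

lemma log_card_le (n : ℕ) (hn : n ≠ 0) (P : Finset ℕ) (c : ℕ → ℝ) (ε : ℝ)
    (hc : ∀ p ∈ P, 0 ≤ c p)
    (h1 : ∀ p ∈ P, p.Prime → ∀ a : ℕ, 1 ≤ a → Real.log (a + 1) ≤ ε * (a * Real.log p) + c p)
    (h2 : ∀ p : ℕ, p.Prime → p ∉ P → Real.log 2 ≤ ε * Real.log p) :
    Real.log (n.divisors.card) ≤ ε * Real.log n + ∑ p ∈ P, c p := by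
  have e1 : Real.log (n.divisors.card) =
      ∑ p ∈ n.primeFactors, Real.log ((n.factorization p : ℝ) + 1) := by
    rw [Nat.card_divisors hn]
    push_cast
    rw [Real.log_prod]
    intro p _
    positivity
  have e2 : Real.log n = ∑ p ∈ n.primeFactors, (n.factorization p : ℝ) * Real.log p := by
    conv_lhs => rw [← Nat.prod_factorization_pow_eq_self hn]
    rw [Finsupp.prod, Nat.support_factorization]
    push_cast
    rw [Real.log_prod]
    · simp
    · intro p hp
      have := (Nat.prime_of_mem_primeFactors hp).pos
      positivity
  have e3 : ∑ p ∈ n.primeFactors, (if p ∈ P then c p else 0) ≤ ∑ p ∈ P, c p := by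
    rw [← Finset.sum_filter]
    apply Finset.sum_le_sum_of_subset_of_nonneg
    · intro p hp
      exact (Finset.mem_filter.1 hp).2
    · intro p hp _
      exact hc p hp
  refine le_trans ?_ (add_le_add_right e3 _)
  rw [e1, e2, Finset.mul_sum, ← Finset.sum_add_distrib]
  apply Finset.sum_le_sum
  intro p hp
  have pp := Nat.prime_of_mem_primeFactors hp
  have ha : 1 ≤ n.factorization p :=
    (pp.dvd_iff_one_le_factorization hn).1 (Nat.dvd_of_mem_primeFactors hp)
  split_ifs with hpP
  · exact h1 p hpP pp _ ha
  · have h3 := h2 p pp hpP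
    have h4 : Real.log ((n.factorization p : ℝ) + 1) ≤ n.factorization p * Real.log 2 := by
      rw [← Real.log_pow]
      apply Real.log_le_log (by positivity)
      have := one_add_mul_le_pow (a := (1:ℝ)) (by norm_num) (n.factorization p)
      norm_num at this
      linarith
    have : (n.factorization p : ℝ) * Real.log 2 ≤ n.factorization p * (ε * Real.log p) := by
      gcongr
    linarith

lemma cert_aux (p q b a : ℕ) (hp : 0 < p) (hq : 0 < q) (h1 : p * b ^ q ≤ (b + 1) ^ q)
    (h2 : (b + 2) ^ q ≤ p * (b + 1) ^ q) :
    Real.log (a + 1) ≤ (1 / q : ℝ) * (a * Real.log p) +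
      (Real.log (b + 1) - (b / q : ℝ) * Real.log p) := by
  have hq' : (0 : ℝ) < q := by exact_mod_cast hq
  have hp' : (0 : ℝ) < p := by exact_mod_cast hp
  suffices h : q * (Real.log (a + 1) - Real.log (b + 1)) ≤ (a - b) * Real.log p by
    have : Real.log (a + 1) - Real.log (b + 1) ≤ ((a - b) * Real.log p) / q := by
      rw [le_div_iff₀ hq']; linarith
    have e : ((a - b) * Real.log p) / q = (1 / q : ℝ) * (a * Real.log p) -
      (b / q : ℝ) * Real.log p := by field_simp
    linarith
  rcases le_total b a with hab | hab
  · obtain ⟨k, rfl⟩ := Nat.exists_eq_add_of_le hab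
    have h3 : (q : ℝ) * Real.log (b + 2) ≤ Real.log p + q * Real.log (b + 1) := by
      rw [← Real.log_pow, ← Real.log_pow, ← Real.log_mul (by positivity) (by positivity)]
      apply Real.log_le_log (by positivity)
      exact_mod_cast h2
    have h4 : Real.log (b + k + 1) - Real.log (b + 1) ≤
        k * (Real.log (b + 2) - Real.log (b + 1)) := by
      rw [← Real.log_div (by positivity) (by positivity),
        ← Real.log_div (by positivity) (by positivity), ← Real.log_pow]
      apply Real.log_le_log (by positivity)
      have := one_add_mul_le_pow (a := (1 / (b + 1) : ℝ))
        (le_trans (by norm_num) (by positivity : (0 : ℝ) ≤ _)) k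
      have e1 : ((b : ℝ) + k + 1) / (b + 1) = 1 + k * (1 / (b + 1)) := by field_simp; ring
      have e2 : ((b : ℝ) + 2) / (b + 1) = 1 + (1 / (b + 1)) := by field_simp; ring
      rw [e1, e2]; exact this
    push_cast
    have h5 := mul_le_mul_of_nonneg_left h4 hq'.le
    have h6 := mul_le_mul_of_nonneg_left h3 (Nat.cast_nonneg (α := ℝ) k)
    nlinarith
  · rcases Nat.eq_or_lt_of_le hab with rfl | hlt
    · simp
    obtain ⟨k, rfl⟩ := Nat.exists_eq_add_of_le hab
    have hb : (0 : ℝ) < ((a + k : ℕ) : ℝ) := by exact_mod_cast (by omega : 0 < a + k)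
    have h3 : Real.log p + q * Real.log ((a + k : ℕ) : ℝ) ≤
        q * Real.log (((a + k : ℕ) : ℝ) + 1) := by
      rw [← Real.log_pow, ← Real.log_pow, ← Real.log_mul (by positivity) (by positivity)]
      apply Real.log_le_log (by positivity)
      exact_mod_cast h1
    have h4 : Real.log (a + 1) - Real.log (((a + k : ℕ) : ℝ) + 1) ≤
        k * (Real.log (((a + k : ℕ) : ℝ)) - Real.log (((a + k : ℕ) : ℝ) + 1)) := by
      rw [← Real.log_div (by positivity) (by positivity),
        ← Real.log_div (by positivity) (by positivity), ← Real.log_pow]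
      apply Real.log_le_log (by positivity)
      have := one_add_mul_le_pow (a := (-(1 / (((a + k : ℕ) : ℝ) + 1)) : ℝ))
        (by
          have : 1 / (((a + k : ℕ) : ℝ) + 1) ≤ 1 := by
            rw [div_le_one (by positivity)]; linarith
          linarith) k
      have e1 : ((a : ℝ) + 1) / (((a + k : ℕ) : ℝ) + 1) =
          1 + k * (-(1 / (((a + k : ℕ) : ℝ) + 1))) := by
        field_simp; push_cast; ring
      have e2 : ((a + k : ℕ) : ℝ) / (((a + k : ℕ) : ℝ) + 1) =
          1 + (-(1 / (((a + k : ℕ) : ℝ) + 1))) := by field_simp; ring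
      rw [e1, e2]; exact this
    have h5 := mul_le_mul_of_nonneg_left h4 hq'.le
    have h6 := mul_le_mul_of_nonneg_left h3 (Nat.cast_nonneg (α := ℝ) k)
    have e : ((a : ℝ) - ((a + k : ℕ) : ℝ)) = -k := by push_cast; ring
    rw [e]
    nlinarith

lemma cert (n : ℕ) (hn : n ≠ 0) (q : ℕ) (hq : 0 < q) (P : Finset ℕ) (b : ℕ → ℕ) (K : ℕ)
    (hP : ∀ p ∈ P, 0 < p ∧ p * b p ^ q ≤ (b p + 1) ^ q ∧ (b p + 2) ^ q ≤ p * (b p + 1) ^ q)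
    (hP2 : ∀ p < 2 ^ q, p.Prime → p ∈ P)
    (hK : ∏ p ∈ P, (b p + 1) ^ q ≤ K * ∏ p ∈ P, p ^ b p) :
    Real.log (n.divisors.card) ≤ (1 / q : ℝ) * Real.log n + Real.log K / q := by
  have hq' : (0 : ℝ) < q := by exact_mod_cast hq
  have key := log_card_le n hn P
    (fun p => Real.log ((b p : ℝ) + 1) - (b p / q : ℝ) * Real.log p) (1 / q)
    (fun p hp => by
      have := cert_aux p q (b p) 0 (hP p hp).1 hq (hP p hp).2.1 (hP p hp).2.2
      simpa using this)
    (fun p hp _ a _ => cert_aux p q (b p) a (hP p hp).1 hq (hP p hp).2.1 (hP p hp).2.2)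
    (fun p pp hp => by
      have h : 2 ^ q ≤ p := by
        by_contra h
        exact hp (hP2 p (by omega) pp)
      have : (q : ℝ) * Real.log 2 ≤ Real.log p := by
        rw [← Real.log_pow]
        apply Real.log_le_log (by positivity)
        exact_mod_cast h
      rw [one_div, inv_mul_eq_div, le_div_iff₀ hq']
      linarith)
  refine key.trans (add_le_add_right ?_ _)
  rw [le_div_iff₀ hq', Finset.sum_mul]
  have hpos : (0 : ℝ) < ∏ p ∈ P, (p : ℝ) ^ b p :=
    Finset.prod_pos fun p hp => by have := (hP p hp).1; positivity
  have hpos2 : (0 : ℝ) < ∏ p ∈ P, ((b p : ℝ) + 1) ^ q :=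
    Finset.prod_pos fun p hp => by positivity
  have e : ∑ p ∈ P, (Real.log ((b p : ℝ) + 1) - (b p / q : ℝ) * Real.log p) * q =
      Real.log (∏ p ∈ P, ((b p : ℝ) + 1) ^ q) - Real.log (∏ p ∈ P, (p : ℝ) ^ b p) := by
    rw [Real.log_prod, Real.log_prod, ← Finset.sum_sub_distrib]
    · apply Finset.sum_congr rfl
      intro p hp
      rw [Real.log_pow, Real.log_pow]
      field_simp
    · intro p hp; have := (hP p hp).1; positivity
    · intro p hp; positivity
  rw [e, sub_le_iff_le_add]
  have hK' : ∏ p ∈ P, ((b p : ℝ) + 1) ^ q ≤ (K : ℝ) * ∏ p ∈ P, (p : ℝ) ^ b p := by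
    exact_mod_cast hK
  have hK0 : (K : ℝ) ≠ 0 := by
    rintro h
    rw [h] at hK'
    linarith
  rw [← Real.log_mul hK0 hpos.ne']
  exact Real.log_le_log hpos2 hK'

lemma finish (m : ℕ) (hm : 3 ≤ m) (hx : 0 < Real.log (Real.log m)) (T : ℝ)
    (h1 : Real.log (m.divisors.card) ≤ T)
    (h2 : T * Real.log (Real.log m) < 1.1 * Real.log m) :
    (m.divisors.card : ℝ) < (m : ℝ) ^ ((1.1 : ℝ) / Real.log (Real.log m)) := by
  have hm0 : (0 : ℝ) < m := by positivity
  have hd : (0 : ℝ) < m.divisors.card := by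
    exact_mod_cast Finset.card_pos.2 ⟨1, Nat.one_mem_divisors.2 (by omega)⟩
  rw [← Real.log_lt_log_iff hd (by positivity), Real.log_rpow hm0]
  refine h1.trans_lt ?_
  rw [div_mul_eq_mul_div, lt_div_iff₀ hx]
  exact h2
lemma log3_le : Real.log 3 ≤ 1.0990 := by
  have h : (41 : ℕ) * Real.log 3 ≤ (65 : ℕ) * Real.log 2 := by
    rw [← Real.log_pow, ← Real.log_pow]
    exact Real.log_le_log (by norm_num) (by norm_num)
  have := Real.log_two_lt_d9
  norm_num at h
  linarith

lemma log3_ge : 1.0974 ≤ Real.log 3 := by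
  have h : (19 : ℕ) * Real.log 2 ≤ (12 : ℕ) * Real.log 3 := by
    rw [← Real.log_pow, ← Real.log_pow]
    exact Real.log_le_log (by norm_num) (by norm_num)
  have := Real.log_two_gt_d9
  norm_num at h
  linarith

lemma log5_ge : 1.6 ≤ Real.log 5 := by
  have h : (65 : ℕ) * Real.log 2 ≤ (28 : ℕ) * Real.log 5 := by
    rw [← Real.log_pow, ← Real.log_pow]
    exact Real.log_le_log (by norm_num) (by norm_num)
  have := Real.log_two_gt_d9
  norm_num at h
  linarith

lemma step (A ε v l0 x1 x2 x : ℝ) (hv : 0 < v) (hl : Real.log v ≤ l0) (h0 : 0 < x1)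
    (hx1 : x1 ≤ x) (hx2 : x ≤ x2) (h12 : x1 < x2) (hA : 0 ≤ A) (hε : 0 ≤ ε)
    (e1 : (ε * x1 + A) * (l0 - 1 + x1 / v) < 1.1 * x1)
    (e2 : (ε * x2 + A) * (l0 - 1 + x2 / v) < 1.1 * x2) :
    (ε * x + A) * Real.log x < 1.1 * x := by
  have hx : 0 < x := by linarith
  have h : Real.log x ≤ l0 - 1 + x / v := by
    have := Real.log_le_sub_one_of_pos (div_pos hx hv)
    rw [Real.log_div hx.ne' hv.ne'] at this
    linarith
  have h3 : (ε * x + A) * Real.log x ≤ (ε * x + A) * (l0 - 1 + x / v) :=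
    mul_le_mul_of_nonneg_left h (by positivity)
  refine h3.trans_lt ?_
  have key : (x2 - x1) * ((ε * x + A) * (l0 - 1 + x / v) - 1.1 * x) =
      (x2 - x) * ((ε * x1 + A) * (l0 - 1 + x1 / v) - 1.1 * x1) +
      (x - x1) * ((ε * x2 + A) * (l0 - 1 + x2 / v) - 1.1 * x2) -
      (ε / v) * ((x - x1) * (x2 - x) * (x2 - x1)) := by
    field_simp; ring
  have hp : 0 ≤ (ε / v) * ((x - x1) * (x2 - x) * (x2 - x1)) := by
    have : 0 ≤ x - x1 := by linarith
    have : 0 ≤ x2 - x := by linarith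
    have : 0 ≤ x2 - x1 := by linarith
    positivity
  by_contra hcon
  push Not at hcon
  have h4 : 0 ≤ (x2 - x1) * ((ε * x + A) * (l0 - 1 + x / v) - 1.1 * x) :=
    mul_nonneg (by linarith) (by linarith)
  rcases eq_or_lt_of_le hx1 with rfl | hlt
  · nlinarith
  · nlinarith [mul_pos (sub_pos.2 hlt) (sub_pos.2 e2),
      mul_nonneg (sub_nonneg.2 hx2) (sub_nonneg.2 e1.le)]

lemma log23 (v : ℝ) (i j k : ℕ) (hv : 0 < v) (h : v * 2 ^ k = 2 ^ i * 3 ^ j) :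
    Real.log v ≤ i * 0.6931471808 + j * 1.0990 - k * 0.6931471803 := by
  have e := congrArg Real.log h
  rw [Real.log_mul hv.ne' (by positivity), Real.log_mul (by positivity) (by positivity),
    Real.log_pow, Real.log_pow, Real.log_pow] at e
  have h1 := mul_le_mul_of_nonneg_left log3_le (Nat.cast_nonneg (α := ℝ) j)
  have h2 := mul_le_mul_of_nonneg_left Real.log_two_lt_d9.le (Nat.cast_nonneg (α := ℝ) i)
  have h3 := mul_le_mul_of_nonneg_left Real.log_two_gt_d9.le (Nat.cast_nonneg (α := ℝ) k)
  linarith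

lemma range4 (x : ℝ) (h1 : 1.05 ≤ x) (h2 : x ≤ 25) :
    ((1 / 4) * x + 2.1390) * Real.log x < 1.1 * x := by
  rcases le_total x 3.6 with h | h
  · exact step _ _ 3 _ 1.05 3.6 x (by norm_num) (log23 _ 0 1 0 (by norm_num) (by norm_num))
      (by norm_num) (by linarith) h (by norm_num) (by norm_num) (by norm_num)
      (by norm_num) (by norm_num)
  rcases le_total x 4.5 with h' | h'
  · exact step _ _ 4 _ 3.6 4.5 x (by norm_num) (log23 _ 2 0 0 (by norm_num) (by norm_num))
      (by norm_num) (by linarith) h' (by norm_num) (by norm_num) (by norm_num)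
      (by norm_num) (by norm_num)
  clear h
  rename' h' => h
  rcases le_total x 5.2 with h' | h'
  · exact step _ _ 4.5 _ 4.5 5.2 x (by norm_num) (log23 _ 0 2 1 (by norm_num) (by norm_num))
      (by norm_num) (by linarith) h' (by norm_num) (by norm_num) (by norm_num)
      (by norm_num) (by norm_num)
  clear h
  rcases le_total x 7.5 with h | h
  · exact step _ _ 6 _ 5.2 7.5 x (by norm_num) (log23 _ 1 1 0 (by norm_num) (by norm_num))
      (by norm_num) (by linarith) h (by norm_num) (by norm_num) (by norm_num)
      (by norm_num) (by norm_num)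
  rcases le_total x 12 with h' | h'
  · exact step _ _ 9 _ 7.5 12 x (by norm_num) (log23 _ 0 2 0 (by norm_num) (by norm_num))
      (by norm_num) (by linarith) h' (by norm_num) (by norm_num) (by norm_num)
      (by norm_num) (by norm_num)
  clear h
  rcases le_total x 18 with h | h
  · exact step _ _ 16 _ 12 18 x (by norm_num) (log23 _ 4 0 0 (by norm_num) (by norm_num))
      (by norm_num) (by linarith) h (by norm_num) (by norm_num) (by norm_num)
      (by norm_num) (by norm_num)
  · exact step _ _ 20.25 _ 18 25 x (by norm_num) (log23 _ 0 4 2 (by norm_num) (by norm_num))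
      (by norm_num) (by linarith) h2 (by norm_num) (by norm_num) (by norm_num)
      (by norm_num) (by norm_num)

lemma range5 (x : ℝ) (h1 : 25 ≤ x) (h2 : x ≤ 100) :
    ((1 / 5) * x + 3.345) * Real.log x < 1.1 * x := by
  rcases le_total x 40 with h | h
  · exact step _ _ 32 _ 25 40 x (by norm_num) (log23 _ 5 0 0 (by norm_num) (by norm_num))
      (by norm_num) (by linarith) h (by norm_num) (by norm_num) (by norm_num)
      (by norm_num) (by norm_num)
  rcases le_total x 70 with h' | h'
  · exact step _ _ 54 _ 40 70 x (by norm_num) (log23 _ 1 3 0 (by norm_num) (by norm_num))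
      (by norm_num) (by linarith) h' (by norm_num) (by norm_num) (by norm_num)
      (by norm_num) (by norm_num)
  · exact step _ _ 96 _ 70 100 x (by norm_num) (log23 _ 5 1 0 (by norm_num) (by norm_num))
      (by norm_num) (by linarith) h2 (by norm_num) (by norm_num) (by norm_num)
      (by norm_num) (by norm_num)

lemma range6 (x : ℝ) (h1 : 100 ≤ x) (h2 : x ≤ 450) :
    ((1 / 6) * x + 4.933) * Real.log x < 1.1 * x := by
  rcases le_total x 300 with h | h
  · exact step _ _ 216 _ 100 300 x (by norm_num) (log23 _ 3 3 0 (by norm_num) (by norm_num))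
      (by norm_num) (by linarith) h (by norm_num) (by norm_num) (by norm_num)
      (by norm_num) (by norm_num)
  · exact step _ _ 432 _ 300 450 x (by norm_num) (log23 _ 4 3 0 (by norm_num) (by norm_num))
      (by norm_num) (by linarith) h2 (by norm_num) (by norm_num) (by norm_num)
      (by norm_num) (by norm_num)

lemma fin4 (n : ℕ) (hn : n ≠ 0) :
    Real.log (n.divisors.card) ≤ (1 / 4) * Real.log n + 2.1390 := by
  have h := cert n hn 4 (by norm_num) {2, 3, 5, 7, 11, 13}
    (fun p => if p = 2 then 5 else if p = 3 then 3 else if p = 5 then 2 else 1) (2 ^ 6 * 3 ^ 4)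
    (by decide) (by decide) (by decide)
  have h2 := log23 (2 ^ 6 * 3 ^ 4) 6 4 0 (by norm_num) (by norm_num)
  push_cast at h h2
  linarith

lemma fin5 (n : ℕ) (hn : n ≠ 0) :
    Real.log (n.divisors.card) ≤ (1 / 5) * Real.log n + 3.345 := by
  have h := cert n hn 5 (by norm_num) {2, 3, 5, 7, 11, 13, 17, 19, 23, 29, 31}
    (fun p => if p = 2 then 6 else if p = 3 then 4 else if p = 5 then 2 else
      if p = 7 then 2 else 1) (2 ^ 13 * 3 ^ 7)
    (by decide) (by decide) (by decide)
  have h2 := log23 (2 ^ 13 * 3 ^ 7) 13 7 0 (by norm_num) (by norm_num)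
  push_cast at h h2
  linarith

set_option maxRecDepth 10000 in
lemma fin6 (n : ℕ) (hn : n ≠ 0) :
    Real.log (n.divisors.card) ≤ (1 / 6) * Real.log n + 4.933 := by
  have h := cert n hn 6 (by norm_num)
    {2, 3, 5, 7, 11, 13, 17, 19, 23, 29, 31, 37, 41, 43, 47, 53, 59, 61}
    (fun p => if p = 2 then 8 else if p = 3 then 4 else if p = 5 then 3 else
      if p = 7 then 2 else if p = 11 then 2 else 1) (2 ^ 30 * 3 ^ 8)
    (by decide) (by decide) (by decide)
  have h2 := log23 (2 ^ 30 * 3 ^ 8) 30 8 0 (by norm_num) (by norm_num)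
  push_cast at h h2
  linarith
lemma prime_cost (u : ℝ) (hu : 0 < u) (a : ℕ) (ha : 1 ≤ a) :
    Real.log (a + 1) ≤ Real.log 2 * (a * u + (1 - u) + max 0 (0.36 / u - 0.6)) := by
  have l2 : 0 < Real.log 2 := Real.log_pos (by norm_num)
  have l2' := Real.log_two_gt_d9
  obtain ⟨k, rfl⟩ := Nat.exists_eq_add_of_le ha
  have l3 : Real.log 3 ≤ 1.6 * Real.log 2 := by
    have h : (5 : ℕ) * Real.log 3 ≤ (8 : ℕ) * Real.log 2 := by
      rw [← Real.log_pow, ← Real.log_pow]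
      exact Real.log_le_log (by norm_num) (by norm_num)
    norm_num at h
    linarith
  push_cast
  rcases le_total 0.6 u with h | h
  · have h4 : Real.log (1 + k + 1) ≤ Real.log 2 + k * (Real.log 3 - Real.log 2) := by
      rw [← Real.log_div (by norm_num) (by norm_num), ← Real.log_pow,
        ← Real.log_mul (by norm_num) (by positivity)]
      apply Real.log_le_log (by positivity)
      have := one_add_mul_le_pow (a := (1 / 2 : ℝ)) (by norm_num) k
      norm_num at this ⊢
      linarith
    have h5 : (k : ℝ) * (Real.log 3 - Real.log 2) ≤ k * (u * Real.log 2) := by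
      apply mul_le_mul_of_nonneg_left _ (by positivity)
      nlinarith
    have h6 : Real.log 2 * 0 ≤ Real.log 2 * max 0 (0.36 / u - 0.6) :=
      mul_le_mul_of_nonneg_left (le_max_left _ _) l2.le
    nlinarith
  · rcases Nat.eq_zero_or_pos k with rfl | hk
    · have h6 : Real.log 2 * 0 ≤ Real.log 2 * max 0 (0.36 / u - 0.6) :=
        mul_le_mul_of_nonneg_left (le_max_left _ _) l2.le
      norm_num at h6 ⊢
      linarith
    have hk' : (1 : ℝ) ≤ k := by exact_mod_cast hk
    set s := Real.sqrt k with hs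
    have hss : s ^ 2 = k := Real.sq_sqrt (by positivity)
    have hs1 : 1 ≤ s := by rw [hs]; exact Real.one_le_sqrt.2 hk'
    have h7 : Real.log ((2 + s ^ 2) / 3) ≤ 0.83 * (s - 1) := by
      rw [Real.log_le_iff_le_exp (by positivity)]
      have := Real.quadratic_le_exp_of_nonneg (x := 0.83 * (s - 1)) (by nlinarith)
      nlinarith [sq_nonneg (s - 1)]
    rw [Real.log_div (by positivity) (by norm_num), hss] at h7
    have h8 : 1.2 * s ≤ k * u + 0.36 / u := by
      rw [← hss, ← sub_nonneg]
      have : s ^ 2 * u + 0.36 / u - 1.2 * s = (s * u - 0.6) ^ 2 / u := by field_simp; ring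
      rw [this]; positivity
    have h9 : Real.log 2 * (0.36 / u - 0.6) ≤ Real.log 2 * max 0 (0.36 / u - 0.6) :=
      mul_le_mul_of_nonneg_left (le_max_right _ _) l2.le
    have h10 := mul_le_mul_of_nonneg_left h8 l2.le
    have e : (1 + k + 1 : ℝ) = 2 + k := by ring
    rw [e]
    nlinarith

lemma jinj (p p' : ℕ) (hp : p.Prime) (hp' : p'.Prime) (h5 : 5 ≤ p) (h5' : 5 ≤ p')
    (h : (p - 1) / 3 = (p' - 1) / 3) : p = p' := by
  have a1 : ¬ 2 ∣ p := fun h => by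
    have := (Nat.prime_dvd_prime_iff_eq Nat.prime_two hp).1 h; omega
  have a2 : ¬ 3 ∣ p := fun h => by
    have := (Nat.prime_dvd_prime_iff_eq Nat.prime_three hp).1 h; omega
  have b1 : ¬ 2 ∣ p' := fun h => by
    have := (Nat.prime_dvd_prime_iff_eq Nat.prime_two hp').1 h; omega
  have b2 : ¬ 3 ∣ p' := fun h => by
    have := (Nat.prime_dvd_prime_iff_eq Nat.prime_three hp').1 h; omega
  have c : p % 6 = 1 ∨ p % 6 = 5 := by omega
  have c' : p' % 6 = 1 ∨ p' % 6 = 5 := by omega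
  clear a1 a2 b1 b2
  rcases c with c | c <;> rcases c' with c' | c' <;> omega

/-- Sum over primes at least 5, bounded via the injection `p ↦ (p-1)/3`. -/
lemma sum_inj (Q : Finset ℕ) (Y : ℝ) (hQ : ∀ p ∈ Q, p.Prime ∧ 5 ≤ p ∧ (p : ℝ) ≤ Y)
    (f g : ℕ → ℝ) (hg : ∀ j ∈ Finset.Icc 1 ⌊Y / 3⌋₊, 0 ≤ g j)
    (hfg : ∀ p ∈ Q, f p ≤ g ((p - 1) / 3)) :
    ∑ p ∈ Q, f p ≤ ∑ j ∈ Finset.Icc 1 ⌊Y / 3⌋₊, g j := by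
  calc ∑ p ∈ Q, f p ≤ ∑ p ∈ Q, g ((p - 1) / 3) := Finset.sum_le_sum hfg
    _ = ∑ j ∈ Q.image (fun p => (p - 1) / 3), g j := by
        rw [Finset.sum_image]
        intro p hp p' hp' h
        exact jinj p p' (hQ p hp).1 (hQ p' hp').1 (hQ p hp).2.1 (hQ p' hp').2.1 h
    _ ≤ _ := by
        apply Finset.sum_le_sum_of_subset_of_nonneg
        · intro j hj
          obtain ⟨p, hp, rfl⟩ := Finset.mem_image.1 hj
          have h := hQ p hp
          rw [Finset.mem_Icc]
          refine ⟨by omega, Nat.le_floor ?_⟩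
          have : 3 * ((p - 1) / 3) ≤ p := by omega
          have : (3 : ℝ) * ((p - 1) / 3 : ℕ) ≤ p := by exact_mod_cast this
          linarith
        · intro j hj _
          exact hg j hj

lemma sum_log_le (z : ℝ) (hz : 1 ≤ z) :
    ∑ j ∈ Finset.Icc 1 ⌊z⌋₊, (Real.log z - Real.log j) ≤ z := by
  set J := ⌊z⌋₊ with hJ
  have hJ1 : 1 ≤ J := Nat.le_floor (by simpa using hz)
  have hJ' : (0 : ℝ) < J := by exact_mod_cast hJ1
  have e : ∑ j ∈ Finset.Icc 1 J, Real.log (j : ℝ) = Real.log (J.factorial) := by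
    clear hJ' hJ1 hJ
    induction J with
    | zero => simp
    | succ k ih =>
      rw [Finset.sum_Icc_succ_top (by omega), ih, Nat.factorial_succ]
      push_cast
      rw [Real.log_mul (by positivity) (by positivity), add_comm]
  rw [Finset.sum_sub_distrib, e]
  simp only [Finset.sum_const, Nat.card_Icc, nsmul_eq_mul, Nat.add_sub_cancel]
  have h1 : J * Real.log z ≤ z + Real.log (J.factorial) := by
    have := Real.pow_div_factorial_le_exp z (by linarith) J
    have h2 := Real.log_le_log (by positivity) this
    rw [Real.log_exp, Real.log_div (by positivity) (by positivity), Real.log_pow] at h2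
    linarith
  linarith

lemma sumA (y : ℝ) (hy : 3 ≤ y) (Q : Finset ℕ)
    (hQ : ∀ p ∈ Q, p.Prime ∧ 5 ≤ p ∧ (p : ℝ) ≤ y) :
    ∑ p ∈ Q, (Real.log y - Real.log p) ≤ y / 3 := by
  refine le_trans (sum_inj Q y hQ _ (fun j => Real.log (y / 3) - Real.log j) ?_ ?_)
    (sum_log_le (y / 3) (by linarith))
  · intro j hj
    rw [Finset.mem_Icc] at hj
    have h1 : (0 : ℝ) < j := by exact_mod_cast hj.1
    have h2 : (j : ℝ) ≤ y / 3 := (Nat.le_floor_iff (by linarith)).1 hj.2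
    have := Real.log_le_log h1 h2
    linarith
  · intro p hp
    have h := hQ p hp
    have h1 : 3 * ((p - 1) / 3) ≤ p := by omega
    have h1' : (3 : ℝ) * ((p - 1) / 3 : ℕ) ≤ p := by exact_mod_cast h1
    have h2 : 0 < (p - 1) / 3 := by omega
    have h2' : (0 : ℝ) < ((p - 1) / 3 : ℕ) := by exact_mod_cast h2
    have h3 := Real.log_le_log (by positivity) h1'
    rw [Real.log_mul (by norm_num) h2'.ne'] at h3
    rw [Real.log_div (by linarith) (by norm_num)]
    linarith

lemma sumB (y L : ℝ) (hL : 6 ≤ L) (Q : Finset ℕ)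
    (hQ : ∀ p ∈ Q, p.Prime ∧ 5 ≤ p ∧ (p : ℝ) ≤ y) :
    ∑ p ∈ Q, max 0 (0.36 / (Real.log p / L) - 0.6) ≤
      Real.exp (0.6 * L) / 3 * (0.225 * L - 0.6) := by
  set Y := Real.exp (0.6 * L) with hY
  have hC : 0 ≤ 0.225 * L - 0.6 := by linarith
  have e : ∑ p ∈ Q, max 0 (0.36 / (Real.log p / L) - 0.6) =
      ∑ p ∈ Q.filter (fun p : ℕ => (p : ℝ) ≤ Y), max 0 (0.36 / (Real.log p / L) - 0.6) := by
    rw [Finset.sum_filter]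
    apply Finset.sum_congr rfl
    intro p hp
    split_ifs with h
    · rfl
    · push Not at h
      apply max_eq_left
      have h1 : 0.6 * L < Real.log p := by
        rw [Real.lt_log_iff_exp_lt (by linarith [Real.exp_pos (0.6 * L)])]
        exact h
      have : 0.36 / (Real.log p / L) ≤ 0.6 := by
        rw [div_le_iff₀ (div_pos (by linarith) (by linarith)), mul_div_assoc',
          le_div_iff₀ (by linarith)]
        linarith
      linarith
  rw [e]
  refine le_trans (sum_inj _ Y ?_ _ (fun _ => 0.225 * L - 0.6) (fun _ _ => hC) ?_) ?_
  · intro p hp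
    rw [Finset.mem_filter] at hp
    exact ⟨(hQ p hp.1).1, (hQ p hp.1).2.1, hp.2⟩
  · intro p hp
    rw [Finset.mem_filter] at hp
    have h5 : (5 : ℝ) ≤ p := by exact_mod_cast (hQ p hp.1).2.1
    have hl : 1.6 ≤ Real.log p := log5_ge.trans (Real.log_le_log (by norm_num) h5)
    apply max_le hC
    have : 0.36 / (Real.log p / L) ≤ 0.225 * L := by
      rw [div_le_iff₀ (div_pos (by linarith) (by linarith)), mul_div_assoc',
        le_div_iff₀ (by linarith)]
      nlinarith
    linarith
  · simp only [Finset.sum_const, Nat.card_Icc, nsmul_eq_mul, Nat.add_sub_cancel]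
    apply mul_le_mul_of_nonneg_right _ hC
    exact Nat.floor_le (by positivity)

lemma final_ineq (L : ℝ) (hL : 6 ≤ L) :
    Real.exp (0.6 * L) / 3 * (0.225 * L - 0.6) * L + 0.85 * L ^ 2 + 0.8 * L
      ≤ 0.2535 * Real.exp L := by
  obtain ⟨t, rfl⟩ : ∃ t, L = 6 + t := ⟨L - 6, by ring⟩
  have ht : 0 ≤ t := by linarith
  have he : Real.exp (6 + t) = Real.exp (0.6 * (6 + t)) * Real.exp (0.4 * (6 + t)) := by
    rw [← Real.exp_add]; congr 1; ring
  have e1 : (2.718 : ℝ) ≤ Real.exp 1 := by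
    have := Real.exp_one_gt_d9; linarith
  have e36 : (36.5 : ℝ) ≤ Real.exp 3.6 := by
    have h : Real.exp 3.6 ^ 5 = Real.exp 1 ^ 18 := by
      rw [← Real.exp_nat_mul, ← Real.exp_nat_mul]; norm_num
    have h2 : (2.718 : ℝ) ^ 18 ≤ Real.exp 1 ^ 18 := by gcongr
    refine le_of_pow_le_pow_left₀ (n := 5) (by norm_num) (Real.exp_pos _).le ?_
    rw [h]; exact le_trans (by norm_num) h2
  have e24 : (11 : ℝ) ≤ Real.exp 2.4 := by
    have h : Real.exp 2.4 ^ 5 = Real.exp 1 ^ 12 := by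
      rw [← Real.exp_nat_mul, ← Real.exp_nat_mul]; norm_num
    have h2 : (2.718 : ℝ) ^ 12 ≤ Real.exp 1 ^ 12 := by gcongr
    refine le_of_pow_le_pow_left₀ (n := 5) (by norm_num) (Real.exp_pos _).le ?_
    rw [h]; exact le_trans (by norm_num) h2
  have hU : 36.5 * (1 + 0.6 * t + (0.6 * t) ^ 2 / 2) ≤ Real.exp (0.6 * (6 + t)) := by
    have : Real.exp (0.6 * (6 + t)) = Real.exp 3.6 * Real.exp (0.6 * t) := by
      rw [← Real.exp_add]; congr 1; ring
    rw [this]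
    exact mul_le_mul e36 (Real.quadratic_le_exp_of_nonneg (by positivity)) (by positivity)
      (Real.exp_pos _).le
  have hV : 11 * (1 + 0.4 * t + (0.4 * t) ^ 2 / 2) ≤ Real.exp (0.4 * (6 + t)) := by
    have : Real.exp (0.4 * (6 + t)) = Real.exp 2.4 * Real.exp (0.4 * t) := by
      rw [← Real.exp_add]; congr 1; ring
    rw [this]
    exact mul_le_mul e24 (Real.quadratic_le_exp_of_nonneg (by positivity)) (by positivity)
      (Real.exp_pos _).le
  rw [he]
  set U := Real.exp (0.6 * (6 + t))
  set V := Real.exp (0.4 * (6 + t))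
  have hU0 : 0 < U := Real.exp_pos _
  have h1 : 0.85 * (6 + t) ^ 2 + 0.8 * (6 + t) ≤ 0.98 * U := by nlinarith [sq_nonneg t]
  have h2 : (0.225 * (6 + t) - 0.6) * (6 + t) / 3 + 0.98 ≤ 0.2535 * V := by
    nlinarith [sq_nonneg t]
  have h3 := mul_le_mul_of_nonneg_left h2 hU0.le
  nlinarith

lemma large (m : ℕ) (hm : 3 ≤ m) (hx : 450 ≤ Real.log m) :
    ∃ T, Real.log (m.divisors.card) ≤ T ∧ T * Real.log (Real.log m) < 1.1 * Real.log m := by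
  set y := Real.log m with hy
  set L := Real.log y with hL
  have hy0 : 0 < y := by linarith
  have hL6 : 6 ≤ L := by
    rw [hL, Real.le_log_iff_exp_le hy0]
    have h : Real.exp 6 = Real.exp 1 ^ 6 := by
      rw [← Real.exp_nat_mul]; norm_num
    have h2 : Real.exp 1 ^ 6 ≤ (2.7183 : ℝ) ^ 6 := by
      have := Real.exp_one_lt_d9
      gcongr; linarith
    rw [h]
    refine h2.trans (le_trans ?_ hx)
    norm_num
  have hL0 : 0 < L := by linarith
  have hexp : Real.exp L = y := Real.exp_log hy0
  have l2 : 0 < Real.log 2 := Real.log_pos (by norm_num)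
  set P := (Finset.Icc 1 ⌊y⌋₊).filter Nat.Prime with hPdef
  have hP : ∀ p ∈ P, p.Prime ∧ (p : ℝ) ≤ y := by
    intro p hp
    rw [hPdef, Finset.mem_filter, Finset.mem_Icc] at hp
    exact ⟨hp.2, (Nat.le_floor_iff hy0.le).1 hp.1.2⟩
  set G : ℕ → ℝ := fun p => max 0 (0.36 / (Real.log p / L) - 0.6) with hG
  have hlp : ∀ p ∈ P, 0 < Real.log p ∧ Real.log p ≤ L := by
    intro p hp
    have h := hP p hp
    have h2 : (2 : ℝ) ≤ p := by exact_mod_cast h.1.two_le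
    exact ⟨Real.log_pos (by linarith), Real.log_le_log (by linarith) h.2⟩
  have key := log_card_le m (by omega) P
    (fun p => Real.log 2 * ((1 - Real.log p / L) + G p)) (Real.log 2 / L)
    (fun p hp => by
      have h := hlp p hp
      have h1 : Real.log p / L ≤ 1 := (div_le_one hL0).2 h.2
      have h2 : 0 ≤ G p := le_max_left _ _
      exact mul_nonneg l2.le (by linarith))
    (fun p hp _ a ha => by
      have h := hlp p hp
      have h1 := prime_cost (Real.log p / L) (div_pos h.1 hL0) a ha
      refine h1.trans (le_of_eq ?_)
      simp only [hG]
      ring)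
    (fun p pp hp => by
      have h : y < p := by
        by_contra h
        push Not at h
        exact hp (by
          rw [hPdef, Finset.mem_filter, Finset.mem_Icc]
          exact ⟨⟨pp.one_le, Nat.le_floor h⟩, pp⟩)
      have h1 : L ≤ Real.log p := Real.log_le_log hy0 h.le
      rw [div_mul_eq_mul_div, le_div_iff₀ hL0]
      exact mul_le_mul_of_nonneg_left h1 l2.le)
  refine ⟨_, key, ?_⟩
  rw [← hy, ← Finset.mul_sum]
  -- split off the primes 2 and 3
  set Q := P.filter (fun p => 5 ≤ p) with hQdef
  have hQ : ∀ p ∈ Q, p.Prime ∧ 5 ≤ p ∧ (p : ℝ) ≤ y := by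
    intro p hp
    rw [hQdef, Finset.mem_filter] at hp
    exact ⟨(hP p hp.1).1, hp.2, (hP p hp.1).2⟩
  have hA := sumA y (by linarith) Q hQ
  have hB := sumB y L hL6 Q hQ
  have hsplit : P = insert 2 (insert 3 Q) := by
    ext p
    simp only [Finset.mem_insert, hQdef, Finset.mem_filter, hPdef, Finset.mem_Icc]
    have hf : 450 ≤ ⌊y⌋₊ := Nat.le_floor (by exact_mod_cast hx)
    constructor
    · rintro ⟨⟨h1, h2⟩, h3⟩
      by_cases h5 : 5 ≤ p
      · exact Or.inr (Or.inr ⟨⟨⟨h1, h2⟩, h3⟩, h5⟩)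
      · have : p < 5 := by omega
        interval_cases p
        · exact absurd h3 (by norm_num)
        · simp
        · simp
        · exact absurd h3 (by norm_num)
    · rintro (rfl | rfl | h)
      · exact ⟨⟨by norm_num, by omega⟩, Nat.prime_two⟩
      · exact ⟨⟨by norm_num, by omega⟩, Nat.prime_three⟩
      · exact h.1
  have h2n : (2 : ℕ) ∉ insert 3 Q := by
    simp [hQdef]
  have h3n : (3 : ℕ) ∉ Q := by
    simp [hQdef]
  rw [hsplit, Finset.sum_insert h2n, Finset.sum_insert h3n, Finset.sum_add_distrib]
  have hA' : ∑ p ∈ Q, (1 - Real.log p / L) ≤ y / 3 / L := by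
    rw [le_div_iff₀ hL0, Finset.sum_mul]
    refine le_trans (le_of_eq ?_) hA
    apply Finset.sum_congr rfl
    intro p _
    rw [← hL]
    field_simp
  have g2 : G 2 ≤ 0.52 * L - 0.6 := by
    apply max_le (by linarith)
    have := Real.log_two_gt_d9
    have : 0.36 / (Real.log (2 : ℕ) / L) ≤ 0.52 * L := by
      push_cast
      rw [div_le_iff₀ (div_pos l2 hL0), mul_div_assoc', le_div_iff₀ hL0]
      nlinarith
    linarith
  have g3 : G 3 ≤ 0.33 * L - 0.6 := by
    apply max_le (by linarith)
    have := log3_ge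
    have : 0.36 / (Real.log (3 : ℕ) / L) ≤ 0.33 * L := by
      push_cast
      rw [div_le_iff₀ (div_pos (by linarith) hL0), mul_div_assoc', le_div_iff₀ hL0]
      nlinarith
    linarith
  have f2 : 0 ≤ Real.log (2 : ℕ) / L := div_nonneg (by push_cast; exact l2.le) hL0.le
  have f3 : 0 ≤ Real.log (3 : ℕ) / L :=
    div_nonneg (by have := log3_ge; push_cast; linarith) hL0.le
  have hfin := final_ineq L hL6
  rw [hexp] at hfin
  set W := Real.exp (0.6 * L) / 3 * (0.225 * L - 0.6) with hW
  have hS : (1 - Real.log (2 : ℕ) / L + G 2 + (1 - Real.log (3 : ℕ) / L + G 3 +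
      (∑ p ∈ Q, (1 - Real.log p / L) + ∑ p ∈ Q, G p))) ≤
      0.8 + 0.85 * L + y / 3 / L + W := by
    have hB' : ∑ p ∈ Q, G p ≤ W := hB
    linarith
  have hSL := mul_le_mul_of_nonneg_right hS hL0.le
  have e3 : (0.8 + 0.85 * L + y / 3 / L + W) * L = 0.8 * L + 0.85 * L ^ 2 + y / 3 + W * L := by
    field_simp
  rw [e3] at hSL
  set S := (1 - Real.log (2 : ℕ) / L + G 2 + (1 - Real.log (3 : ℕ) / L + G 3 +
      (∑ p ∈ Q, (1 - Real.log p / L) + ∑ p ∈ Q, G p)))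
  have e4 : (Real.log 2 / L * y + Real.log 2 * S) * L = Real.log 2 * (y + S * L) := by
    field_simp
  rw [e4]
  have h10 : y + S * L ≤ 1.58684 * y := by linarith
  have h11 := mul_le_mul_of_nonneg_left h10 l2.le
  have := Real.log_two_lt_d9
  nlinarith

/-- For every `m ≥ 3`, the number of positive divisors of `m` satisfies
`σ₀(m) < m^{1.1 / log log m}`. -/
theorem card_divisors_lt (m : ℕ) (hm : 3 ≤ m) :
    (m.divisors.card : ℝ) < (m : ℝ) ^ ((1.1 : ℝ) / Real.log (Real.log m)) := by
  have hm0 : m ≠ 0 := by omega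
  have hx : 1.05 ≤ Real.log m := by
    have h : (3 : ℝ) ≤ m := by exact_mod_cast hm
    have := Real.log_le_log (by norm_num) h
    have := log3_ge
    linarith
  have hll : 0 < Real.log (Real.log m) := Real.log_pos (by linarith)
  rcases le_total (Real.log m) 25 with h | h
  · exact finish m hm hll _ (fin4 m hm0) (range4 _ hx h)
  rcases le_total (Real.log m) 100 with h' | h'
  · exact finish m hm hll _ (fin5 m hm0) (range5 _ h h')
  rcases le_total (Real.log m) 450 with h2 | h2
  · exact finish m hm hll _ (fin6 m hm0) (range6 _ h' h2)
  · obtain ⟨T, h3, h4⟩ := large m hm h2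
    exact finish m hm hll T h3 h4
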